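/- Consider the q-HATM iteration for Example 4.5 with α = 1, h = −1, n = 1: v₀(x,y,z,t) = sinh(x)sinh(y)sinh(z)·(1 − 2t) and, for m ≥ 1, v_m(x,y,z,t) = k_m·v_{m-1}(x,y,z,t) − [ v_{m-1}(x,y,z,t) − (1 − k_m)·sinh(x)sinh(y)sinh(z)·(1 − 2t) + ∫₀ᵗ (t − τ)·( 2·∂_τ v_{m-1} + 3·v_{m-1} − ∂²_x v_{m-1} − ∂²_y v_{m-1} − ∂²_z v_{m-1} )(x,y,z,τ) dτ ], with k₁ = 0 and k_m = 1 for m ≥ 2. Then for every m ≥ 1 and all real x, y, z, t one has v_m(x,y,z,t) = sinh(x)sinh(y)sinh(z)·(−2)^{m+1}·t^{m+1}/(m+1)!, and consequently the q-HATM series converges with Σ_{m=0}^{∞} v_m(x,y,z,t) = e^{−2t}·sinh(x)sinh(y)sinh(z), the exact solution. -/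

import Mathlib

theorem integral_sub_mul_pow (m : ℕ) (t : ℝ) :
    ∫ τ in (0 : ℝ)..t, (t - τ) * τ ^ m = t ^ (m + 2) / ((m + 1) * (m + 2)) := by
  have h : ∀ τ : ℝ, (t - τ) * τ ^ m = t * τ ^ m - τ ^ (m + 1) := fun τ => by ring
  simp only [h]
  rw [intervalIntegral.integral_sub
    (Continuous.intervalIntegrable (by fun_prop) _ _)
    (Continuous.intervalIntegrable (by fun_prop) _ _),
    intervalIntegral.integral_const_mul, integral_pow, integral_pow]
  push_cast
  field_simp
  ring

theorem deriv_deriv_mul_sinh_mul (c d x : ℝ) :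
    deriv (deriv fun a => c * Real.sinh a * d) x = c * Real.sinh x * d := by
  have h1 : deriv (fun a => c * Real.sinh a * d) = fun a => c * Real.cosh a * d :=
    funext fun a => (((Real.hasDerivAt_sinh a).const_mul c).mul_const d).deriv
  rw [h1]
  exact (((Real.hasDerivAt_cosh x).const_mul c).mul_const d).deriv

/-- The telegraph operator without its `∂²_t` term, applied to a separated function
`sinh x sinh y sinh z · g(t)`, leaves only the damping term `2 g'(t)`. -/
theorem telegraph_residual_of_separated {u : ℝ → ℝ → ℝ → ℝ → ℝ} {g : ℝ → ℝ} {g' : ℝ}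
    (hu : ∀ x y z t, u x y z t = Real.sinh x * Real.sinh y * Real.sinh z * g t)
    {τ : ℝ} (hg : HasDerivAt g g' τ) (x y z : ℝ) :
    2 * deriv (fun s => u x y z s) τ + 3 * u x y z τ
      - deriv (deriv (fun a => u a y z τ)) x
      - deriv (deriv (fun b => u x b z τ)) y
      - deriv (deriv (fun c => u x y c τ)) z
      = 2 * (Real.sinh x * Real.sinh y * Real.sinh z * g') := by
  have ht : deriv (fun s => u x y z s) τ = Real.sinh x * Real.sinh y * Real.sinh z * g' := by
    simp only [hu]
    exact (hg.const_mul _).deriv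
  have hx : deriv (deriv (fun a => u a y z τ)) x = u x y z τ := by
    have e : (fun a => u a y z τ)
        = fun a => 1 * Real.sinh a * (Real.sinh y * Real.sinh z * g τ) :=
      funext fun a => by rw [hu]; ring
    rw [e, deriv_deriv_mul_sinh_mul, hu]; ring
  have hy : deriv (deriv (fun b => u x b z τ)) y = u x y z τ := by
    have e : (fun b => u x b z τ)
        = fun b => Real.sinh x * Real.sinh b * (Real.sinh z * g τ) :=
      funext fun b => by rw [hu]; ring
    rw [e, deriv_deriv_mul_sinh_mul, hu]; ring
  have hz : deriv (deriv (fun c => u x y c τ)) z = u x y z τ := by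
    have e : (fun c => u x y c τ)
        = fun c => Real.sinh x * Real.sinh y * Real.sinh c * g τ :=
      funext fun c => by rw [hu]
    rw [e, deriv_deriv_mul_sinh_mul, hu]
  rw [ht, hx, hy, hz]; ring


/-- q-HATM iterates for Example 4.5 (α = 1, h = -1, n = 1): the closed form
`v_m(x,y,z,t) = sinh x sinh y sinh z · (-2)^{m+1} t^{m+1}/(m+1)!` for `m ≥ 1`, and the
series sums to the exact solution `e^{-2t} sinh x sinh y sinh z`. -/
theorem stmt_12 (v : ℕ → ℝ → ℝ → ℝ → ℝ → ℝ)
    (hv0 : ∀ x y z t, v 0 x y z t =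
      Real.sinh x * Real.sinh y * Real.sinh z * (1 - 2 * t))
    (hrec : ∀ m : ℕ, ∀ x y z t : ℝ,
      v (m + 1) x y z t =
        (if m = 0 then (0 : ℝ) else 1) * v m x y z t -
          (v m x y z t
            - (1 - (if m = 0 then (0 : ℝ) else 1)) *
                (Real.sinh x * Real.sinh y * Real.sinh z * (1 - 2 * t))
            + ∫ τ in (0:ℝ)..t, (t - τ) *
                (2 * deriv (fun s => v m x y z s) τ + 3 * v m x y z τ
                  - deriv (deriv (fun a => v m a y z τ)) x
                  - deriv (deriv (fun b => v m x b z τ)) y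
                  - deriv (deriv (fun c => v m x y c τ)) z))) :
    ∀ x y z t : ℝ,
      (∀ m : ℕ, 1 ≤ m →
        v m x y z t = Real.sinh x * Real.sinh y * Real.sinh z
                        * (-2) ^ (m + 1) * t ^ (m + 1) / (Nat.factorial (m + 1))) ∧
      HasSum (fun m => v m x y z t)
        (Real.exp (-2 * t) * Real.sinh x * Real.sinh y * Real.sinh z) := by
  have hform : ∀ m : ℕ, ∀ x y z t : ℝ, v (m + 1) x y z t =
      Real.sinh x * Real.sinh y * Real.sinh z *
        ((-2) ^ (m + 2) * t ^ (m + 2) / (Nat.factorial (m + 2))) := by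
    intro m
    induction m with
    | zero =>
      intro x y z t
      have hg : ∀ τ : ℝ, HasDerivAt (fun t : ℝ => 1 - 2 * t) (-2) τ := fun τ => by
        simpa using ((hasDerivAt_id τ).const_mul 2).const_sub 1
      rw [hrec 0]
      simp only [fun τ => telegraph_residual_of_separated hv0 (hg τ) x y z]
      have hI := integral_sub_mul_pow 0 t
      simp only [pow_zero, mul_one] at hI
      rw [intervalIntegral.integral_mul_const, hI, hv0]
      norm_num [Nat.factorial]
      ring
    | succ m ih =>
      intro x y z t
      have hg : ∀ τ : ℝ, HasDerivAt
          (fun t : ℝ => (-2) ^ (m + 2) * t ^ (m + 2) / (Nat.factorial (m + 2) : ℝ))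
          ((-2) ^ (m + 2) * τ ^ (m + 1) / (Nat.factorial (m + 1))) τ := fun τ => by
        refine (((hasDerivAt_pow (m + 2) τ).const_mul ((-2) ^ (m + 2))).div_const
          (Nat.factorial (m + 2) : ℝ)).congr_deriv ?_
        rw [Nat.factorial_succ (m + 1)]
        push_cast
        field_simp
        ring
      rw [hrec (m + 1)]
      simp only [fun τ => telegraph_residual_of_separated ih (hg τ) x y z]
      have e : ∀ τ : ℝ, (t - τ) * (2 * (Real.sinh x * Real.sinh y * Real.sinh z *
            ((-2) ^ (m + 2) * τ ^ (m + 1) / (Nat.factorial (m + 1)))))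
          = (2 * (Real.sinh x * Real.sinh y * Real.sinh z *
            ((-2) ^ (m + 2) / (Nat.factorial (m + 1))))) * ((t - τ) * τ ^ (m + 1)) :=
        fun τ => by ring
      simp only [e]
      rw [intervalIntegral.integral_const_mul, integral_sub_mul_pow,
        if_neg (Nat.succ_ne_zero m), Nat.factorial_succ (m + 2), Nat.factorial_succ (m + 1)]
      push_cast
      field_simp
      ring
  intro x y z t
  refine ⟨fun m hm => ?_, ?_⟩
  · obtain ⟨k, rfl⟩ := Nat.exists_eq_add_of_le' hm
    rw [hform]
    ring
  · have hexp : HasSum (fun n : ℕ => (-2 * t) ^ n / (Nat.factorial n : ℝ))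
        (Real.exp (-2 * t)) := by
      rw [Real.exp_eq_exp_ℝ]
      exact NormedSpace.expSeries_div_hasSum_exp (-2 * t)
    have htail := ((hasSum_nat_add_iff' 2).mpr hexp).mul_left
      (Real.sinh x * Real.sinh y * Real.sinh z)
    have hterm : ∀ m : ℕ, Real.sinh x * Real.sinh y * Real.sinh z *
        ((-2 * t) ^ (m + 2) / (Nat.factorial (m + 2) : ℝ)) = v (m + 1) x y z t := fun m => by
      rw [hform, mul_pow]
    have hsum : Real.sinh x * Real.sinh y * Real.sinh z * (Real.exp (-2 * t)
          - ∑ i ∈ Finset.range 2, (-2 * t) ^ i / (Nat.factorial i : ℝ))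
        = Real.exp (-2 * t) * Real.sinh x * Real.sinh y * Real.sinh z
          - ∑ i ∈ Finset.range 1, v i x y z t := by
      simp only [Finset.sum_range_succ, Finset.sum_range_zero, hv0]
      norm_num
      ring
    simp only [hterm] at htail
    rw [hsum] at htail
    exact (hasSum_nat_add_iff' 1).mp htail
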